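/- For all integers s ≥ 0 and k ≥ 1, the Jacobi parameters satisfy a_{2^s(2k+1)}² · a_{2^s(2k+1)−1}² ⋯ a_{2^{s+1}k+1}² + a_{2^{s+1}k}² · a_{2^{s+1}k−1}² ⋯ a_{2^{s+1}k−2^s+1}² = ||Q_{2^s}||²; that is, ∏_{j=2^{s+1}k+1}^{2^s(2k+1)} a_j² + ∏_{j=2^{s+1}k−2^s+1}^{2^{s+1}k} a_j² = ||Q_{2^s}||². -/

import Mathlib

open Polynomial MeasureTheory Filter

/-- `r γ s` : the recursively defined scales `r 0 = 1`, `r (s+1) = γ (s+1) * (r s)²`. -/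
noncomputable def r (γ : ℕ → ℝ) : ℕ → ℝ
  | 0 => 1
  | s + 1 => γ (s + 1) * (r γ s) ^ 2

/-- `P γ s` : the polynomial `P_{2^s}`, with `P_1 = X - 1` and
`P_{2^{s+1}} = P_{2^s} · (P_{2^s} + r_s)`. -/
noncomputable def P (γ : ℕ → ℝ) : ℕ → Polynomial ℝ
  | 0 => X - 1
  | s + 1 => P γ s * (P γ s + C (r γ s))

/-- The integral `∫ f dν_s` of a function `f` against the normalized counting measure `ν_s`
on the `2^s` (simple, real) zeros of `P_{2^s} + r_s/2`. -/
noncomputable def nuInt (γ : ℕ → ℝ) (s : ℕ) (f : ℝ → ℝ) : ℝ :=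
  (((P γ s + C (r γ s / 2)).roots.map f).sum) / 2 ^ s

/-- The Jacobi parameters `a_n = ‖Q_n‖ / ‖Q_{n-1}‖` (`n ≥ 1`), where
`‖f‖ = (∫ f² dμ)^{1/2}`, together with the convention `a_0 = 0`. -/
noncomputable def jacobiA (μ : MeasureTheory.Measure ℝ) (Q : ℕ → Polynomial ℝ) : ℕ → ℝ
  | 0 => 0
  | n + 1 => Real.sqrt (∫ x, ((Q (n + 1)).eval x) ^ 2 ∂μ) /
      Real.sqrt (∫ x, ((Q n).eval x) ^ 2 ∂μ)


noncomputable def TT (γ : ℕ → ℝ) (n : ℕ) : Polynomial ℝ := P γ n + C (r γ n / 2)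

noncomputable def SS (γ : ℕ → ℝ) (n : ℕ) (y : ℝ) (f : ℝ → ℝ) : ℝ :=
  ((TT γ n - C y).roots.map f).sum

theorem r_pos (γ : ℕ → ℝ) (hγ : ∀ s : ℕ, 0 < γ (s + 1) ∧ γ (s + 1) < 1 / 4) (n : ℕ) :
    0 < r γ n := by
  induction n with
  | zero => simp [r]
  | succ n ih => 
    have := (hγ n).1
    simp only [r]; positivity

theorem monic_add_C {p : Polynomial ℝ} {n : ℕ} (hp : p.Monic) (hd : p.natDegree = n) (hn : 0 < n)
    (a : ℝ) : (p + C a).Monic ∧ (p + C a).natDegree = n := by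
  refine ⟨hp.add_of_left ?_, by rw [natDegree_add_C, hd]⟩
  rw [degree_eq_natDegree hp.ne_zero, hd]
  exact lt_of_le_of_lt degree_C_le (by exact_mod_cast hn)

theorem P_monic (γ : ℕ → ℝ) (n : ℕ) : (P γ n).Monic ∧ (P γ n).natDegree = 2 ^ n := by
  induction n with
  | zero => 
    simp only [P]
    exact ⟨by simpa using monic_X_sub_C (1:ℝ), by simpa using natDegree_X_sub_C (1:ℝ)⟩
  | succ n ih => 
    have h := monic_add_C ih.1 ih.2 (by positivity) (r γ n)
    simp only [P]
    refine ⟨ih.1.mul h.1, ?_⟩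
    rw [ih.1.natDegree_mul h.1, ih.2, h.2]; ring

theorem TT_monic (γ : ℕ → ℝ) (n : ℕ) : (TT γ n).Monic ∧ (TT γ n).natDegree = 2 ^ n :=
  monic_add_C (P_monic γ n).1 (P_monic γ n).2 (by positivity) _

theorem TT_sub_monic (γ : ℕ → ℝ) (n : ℕ) (y : ℝ) : (TT γ n - C y).Monic := by
  have := (monic_add_C (TT_monic γ n).1 (TT_monic γ n).2 (by positivity) (-y)).1
  simpa [sub_eq_add_neg] using this

theorem TT_succ (γ : ℕ → ℝ) (n : ℕ) :
    TT γ (n + 1) = TT γ n * TT γ n - C ((r γ n) ^ 2 / 4 - r γ (n + 1) / 2) := by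
  simp only [TT, P]
  have : (C (r γ n) : ℝ[X]) = C (r γ n / 2) + C (r γ n / 2) := by rw [← C_add]; congr 1; ring
  have h2 : (C ((r γ n) ^ 2 / 4 - r γ (n + 1) / 2) : ℝ[X])
      = C (r γ n / 2) * C (r γ n / 2) - C (r γ (n+1) / 2) := by
    rw [← C_mul, ← C_sub]; congr 1; ring
  rw [h2, this]; ring

theorem SS_succ (γ : ℕ → ℝ) (hγ : ∀ s : ℕ, 0 < γ (s + 1) ∧ γ (s + 1) < 1 / 4) (n : ℕ) (y : ℝ)
    (hy : |y| ≤ r γ (n + 1) / 2) :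
    ∃ w : ℝ, |w| ≤ r γ n / 2 ∧ ∀ f, SS γ (n + 1) y f = SS γ n w f + SS γ n (-w) f := by
  have hr := r_pos γ hγ n
  have hr1 : r γ (n + 1) = γ (n + 1) * (r γ n) ^ 2 := rfl
  obtain ⟨g1, g2⟩ := hγ n
  have h4 : r γ (n + 1) ≤ (r γ n) ^ 2 / 4 := by
    rw [hr1]; nlinarith [sq_nonneg (r γ n)]
  obtain ⟨y1, y2⟩ := abs_le.1 hy
  set z := (r γ n) ^ 2 / 4 - r γ (n + 1) / 2 + y with hz
  have hz0 : 0 ≤ z := by linarith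
  have hz1 : z ≤ (r γ n / 2) ^ 2 := by nlinarith
  refine ⟨Real.sqrt z, ?_, fun f => ?_⟩
  · rw [abs_of_nonneg (Real.sqrt_nonneg _)]
    exact Real.sqrt_le_iff.2 ⟨by positivity, hz1⟩
  · have hfac : TT γ (n + 1) - C y = (TT γ n - C (Real.sqrt z)) * (TT γ n - C (-Real.sqrt z)) := by
      have h2 : (C (Real.sqrt z) * C (Real.sqrt z) : ℝ[X]) =
          C ((r γ n) ^ 2 / 4 - r γ (n + 1) / 2) + C y := by
        rw [← C_mul, Real.mul_self_sqrt hz0, ← C_add]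
      rw [TT_succ, C_neg]
      linear_combination h2
    unfold SS
    rw [hfac, roots_mul (mul_ne_zero (TT_sub_monic _ _ _).ne_zero (TT_sub_monic _ _ _).ne_zero),
      Multiset.map_add, Multiset.sum_add]

theorem SS_up (γ : ℕ → ℝ) (hγ : ∀ s : ℕ, 0 < γ (s + 1) ∧ γ (s + 1) < 1 / 4) (m : ℕ)
    (f₁ f₂ : ℝ → ℝ) (h : ∀ y, |y| ≤ r γ m / 2 → SS γ m y f₁ = SS γ m y f₂) (n : ℕ) (hn : m ≤ n) :
    ∀ y, |y| ≤ r γ n / 2 → SS γ n y f₁ = SS γ n y f₂ := by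
  induction n, hn using Nat.le_induction with
  | base => exact h
  | succ n hn ih =>
    intro y hy
    obtain ⟨w, hw, hS⟩ := SS_succ γ hγ n y hy
    rw [hS, hS, ih w hw, ih (-w) (by rwa [abs_neg])]

theorem SS_congr (γ : ℕ → ℝ) (n : ℕ) (y : ℝ) (f : ℝ → ℝ) (g : ℝ → ℝ → ℝ)
    (hf : ∀ x, f x = g ((TT γ n).eval x) x) : SS γ n y f = SS γ n y (g y) := by
  unfold SS
  congr 1
  apply Multiset.map_congr rfl
  intro x hx
  have := (mem_roots'.1 hx).2
  rw [hf]; congr 1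
  simp [IsRoot] at this
  linarith

theorem SS_mul (γ : ℕ → ℝ) (n : ℕ) (y a : ℝ) (f : ℝ → ℝ) :
    SS γ n y (fun x => a * f x) = a * SS γ n y f := by
  simp [SS, Multiset.sum_map_mul_left]

theorem SS_add (γ : ℕ → ℝ) (n : ℕ) (y : ℝ) (f g : ℝ → ℝ) :
    SS γ n y (fun x => f x + g x) = SS γ n y f + SS γ n y g := by
  simp [SS, Multiset.sum_map_add]

/-- Euclidean division by a monic polynomial, with degree control. -/
theorem div_decomp {T p : ℝ[X]} (hT : T.Monic) {N n : ℕ} (hN : T.natDegree = N)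
    (hp : p.degree < ((n + 1) * N : ℕ)) :
    ∃ p0 p1 : ℝ[X], p = p0 + T * p1 ∧ p0.degree < (N : ℕ) ∧ p1.degree < (n * N : ℕ) := by
  refine ⟨p %ₘ T, p /ₘ T, (modByMonic_add_div p T).symm, ?_, ?_⟩
  · have := degree_modByMonic_lt p hT
    rwa [degree_eq_natDegree hT.ne_zero, hN] at this
  · by_cases h0 : p /ₘ T = 0
    · rw [h0, degree_zero]; exact WithBot.bot_lt_coe _
    · have hp0 : p ≠ 0 := by rintro rfl; simp at h0
      have h1 := natDegree_divByMonic p hT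
      have hdeg : N ≤ p.natDegree := by
        by_contra hlt
        push Not at hlt
        apply h0
        rw [divByMonic_eq_zero_iff hT]
        rw [degree_eq_natDegree hp0, degree_eq_natDegree hT.ne_zero, hN]
        exact_mod_cast hlt
      rw [degree_eq_natDegree hp0] at hp
      have hp' : p.natDegree < (n + 1) * N := by exact_mod_cast hp
      rw [degree_eq_natDegree h0, h1, hN]
      have : p.natDegree - N < n * N := by
        rw [add_mul] at hp'; omega
      exact_mod_cast this

theorem SS_const (γ : ℕ → ℝ) (hγ : ∀ s : ℕ, 0 < γ (s + 1) ∧ γ (s + 1) < 1 / 4) (n : ℕ) :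
    ∀ p : ℝ[X], p.degree < (2 ^ n : ℕ) →
      ∃ K : ℝ, ∀ y, |y| ≤ r γ n / 2 → SS γ n y (fun x => p.eval x) = K := by
  induction n with
  | zero =>
    intro p hp
    have : p.degree ≤ 0 := by
      rw [← Nat.cast_zero, degree_le_iff_coeff_zero]
      intro m hm
      apply coeff_eq_zero_of_degree_lt
      refine lt_of_lt_of_le hp ?_
      have hm' : 0 < m := by exact_mod_cast hm
      exact_mod_cast hm'
    rw [eq_C_of_degree_le_zero this]
    refine ⟨p.coeff 0, fun y _ => ?_⟩
    have h : TT γ 0 - C y = X - C (1 - 1/2 + y) := by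
      simp only [TT, P, r, C_add, C_sub, C_1]; ring
    rw [SS, h, roots_X_sub_C]; simp
  | succ n ih =>
    intro p hp
    obtain ⟨p0, p1, rfl, h0, h1⟩ := div_decomp (n := 1) (TT_monic γ n).1 (TT_monic γ n).2
      (p := p) (by convert hp using 2; ring)
    rw [one_mul] at h1
    obtain ⟨K0, hK0⟩ := ih p0 h0
    obtain ⟨K1, hK1⟩ := ih p1 h1
    have key : ∀ w, |w| ≤ r γ n / 2 →
        SS γ n w (fun x => (p0 + TT γ n * p1).eval x) = K0 + w * K1 := by
      intro w hw
      rw [SS_congr γ n w _ (fun t x => p0.eval x + t * p1.eval x) (by intro x; simp), SS_add,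
        SS_mul, hK0 w hw, hK1 w hw]
    refine ⟨2 * K0, fun y hy => ?_⟩
    obtain ⟨w, hw, hS⟩ := SS_succ γ hγ n y hy
    rw [hS, key w hw, key (-w) (by rwa [abs_neg])]; ring

theorem SS_one (γ : ℕ → ℝ) (hγ : ∀ s : ℕ, 0 < γ (s + 1) ∧ γ (s + 1) < 1 / 4) (n : ℕ) :
    ∀ y, |y| ≤ r γ n / 2 → SS γ n y (fun _ => 1) = 2 ^ n := by
  induction n with
  | zero =>
    intro y _
    have h : TT γ 0 - C y = X - C (1 - 1/2 + y) := by
      simp only [TT, P, r, C_add, C_sub, C_1]; ring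
    rw [SS, h, roots_X_sub_C]; simp
  | succ n ih =>
    intro y hy
    obtain ⟨w, hw, hS⟩ := SS_succ γ hγ n y hy
    rw [hS, ih w hw, ih (-w) (by rwa [abs_neg])]; ring

theorem Lf_eq (γ : ℕ → ℝ) (hγ : ∀ s : ℕ, 0 < γ (s + 1) ∧ γ (s + 1) < 1 / 4)
    (L : ℝ[X] →ₗ[ℝ] ℝ)
    (hL : ∀ p : ℝ[X], Tendsto (fun s => nuInt γ s (fun x => p.eval x)) atTop (nhds (L p)))
    (m : ℕ) (p₁ p₂ : ℝ[X])
    (h : ∀ y, |y| ≤ r γ m / 2 → SS γ m y (fun x => p₁.eval x) = SS γ m y (fun x => p₂.eval x)) :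
    L p₁ = L p₂ := by
  refine tendsto_nhds_unique_of_eventuallyEq (hL p₁) (hL p₂) ?_
  filter_upwards [eventually_ge_atTop m] with n hn
  have := SS_up γ hγ m _ _ h n hn 0 (by rw [abs_zero]; exact (half_pos (r_pos γ hγ n)).le)
  simp only [SS, C_0, sub_zero, TT] at this
  simp only [nuInt, this]

theorem Lf_symm (γ : ℕ → ℝ) (hγ : ∀ s : ℕ, 0 < γ (s + 1) ∧ γ (s + 1) < 1 / 4)
    (L : ℝ[X] →ₗ[ℝ] ℝ)
    (hL : ∀ p : ℝ[X], Tendsto (fun s => nuInt γ s (fun x => p.eval x)) atTop (nhds (L p)))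
    (s : ℕ) (g : ℝ[X]) : L ((g.comp (-X)).comp (TT γ s)) = L (g.comp (TT γ s)) := by
  apply Lf_eq γ hγ L hL (s + 1)
  intro y hy
  obtain ⟨w, hw, hS⟩ := SS_succ γ hγ s y hy
  have hw' : |(-w)| ≤ r γ s / 2 := by rwa [abs_neg]
  have key : ∀ g : ℝ[X], ∀ w, |w| ≤ r γ s / 2 →
      SS γ s w (fun x => (g.comp (TT γ s)).eval x) = g.eval w * 2 ^ s := by
    intro g w hw
    rw [SS_congr γ s w _ (fun t _ => g.eval t * 1) (by intro x; simp [eval_comp]), SS_mul,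
      SS_one γ hγ s w hw]
  rw [hS, hS, key _ w hw, key _ _ hw', key _ w hw, key _ _ hw']
  simp [eval_comp]; ring

theorem Lf_mul (γ : ℕ → ℝ) (hγ : ∀ s : ℕ, 0 < γ (s + 1) ∧ γ (s + 1) < 1 / 4)
    (L : ℝ[X] →ₗ[ℝ] ℝ)
    (hL : ∀ p : ℝ[X], Tendsto (fun s => nuInt γ s (fun x => p.eval x)) atTop (nhds (L p)))
    (hL1 : L 1 = 1) (s : ℕ) (p g : ℝ[X]) (hp : p.degree < (2 ^ s : ℕ)) :
    L (g.comp (TT γ s) * p) = L p * L (g.comp (TT γ s)) := by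
  obtain ⟨K, hK⟩ := SS_const γ hγ s p hp
  have key : ∀ g : ℝ[X], L (g.comp (TT γ s) * p) = (K / 2 ^ s) * L (g.comp (TT γ s)) := by
    intro g
    rw [← smul_eq_mul (K / 2 ^ s), ← map_smul]
    apply Lf_eq γ hγ L hL s
    intro y hy
    rw [SS_congr γ s y _ (fun t x => g.eval t * p.eval x) (by intro x; simp [eval_comp]), SS_mul,
      hK y hy, SS_congr γ s y (fun x => _) (fun t _ => (K / 2 ^ s * g.eval t) * 1)
        (by intro x; simp [eval_comp]), SS_mul, SS_one γ hγ s y hy]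
    field_simp
  have h1 := key 1
  simp only [one_comp, one_mul, hL1, mul_one] at h1
  rw [key g, h1]

theorem Lf_orth (γ : ℕ → ℝ) (hγ : ∀ s : ℕ, 0 < γ (s + 1) ∧ γ (s + 1) < 1 / 4)
    (L : ℝ[X] →ₗ[ℝ] ℝ)
    (hL : ∀ p : ℝ[X], Tendsto (fun s => nuInt γ s (fun x => p.eval x)) atTop (nhds (L p)))
    (hL1 : L 1 = 1) (s : ℕ) (n : ℕ) : ∀ (p q : ℝ[X]), p.degree < (n * 2 ^ s : ℕ) →
    (∀ h : ℝ[X], h.degree < (n : ℕ) → L ((q * h).comp (TT γ s)) = 0) →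
    L (q.comp (TT γ s) * p) = 0 := by
  induction n with
  | zero =>
    intro p q hp _
    have : p = 0 := by
      rw [← degree_eq_bot]
      simpa using hp
    simp [this]
  | succ n ih =>
    intro p q hp hq
    obtain ⟨p0, p1, rfl, h0, h1⟩ := div_decomp (TT_monic γ s).1 (TT_monic γ s).2 hp
    rw [mul_add, map_add, Lf_mul γ hγ L hL hL1 s p0 q h0]
    have e1 : L (q.comp (TT γ s)) = 0 := by
      have := hq 1 (by rw [degree_one]; exact_mod_cast Nat.succ_pos n)
      simpa using this
    have e2 : q.comp (TT γ s) * (TT γ s * p1) = (q * X).comp (TT γ s) * p1 := by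
      simp; ring
    rw [e1, e2, ih p1 (q * X) h1, mul_zero, add_zero]
    intro h hh
    rw [mul_assoc]
    apply hq
    by_cases h0 : h = 0
    · simp [h0]
    · rw [degree_mul, degree_X, degree_eq_natDegree h0]
      rw [degree_eq_natDegree h0] at hh
      have : h.natDegree < n := by exact_mod_cast hh
      have : 1 + h.natDegree < n + 1 := by omega
      exact_mod_cast this

/-- Orthogonal polynomials of a symmetric functional. -/
noncomputable def qq (Λ : ℝ[X] →ₗ[ℝ] ℝ) : ℕ → ℝ[X]
  | 0 => 1
  | 1 => X
  | n + 2 => X * qq Λ (n + 1) -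
      C (Λ (qq Λ (n + 1) * qq Λ (n + 1)) / Λ (qq Λ n * qq Λ n)) * qq Λ n

theorem qq_two (Λ : ℝ[X] →ₗ[ℝ] ℝ) (n : ℕ) : qq Λ (n + 2) = X * qq Λ (n + 1) -
      C (Λ (qq Λ (n + 1) * qq Λ (n + 1)) / Λ (qq Λ n * qq Λ n)) * qq Λ n := by
  rw [qq]

theorem qq_monic (Λ : ℝ[X] →ₗ[ℝ] ℝ) (n : ℕ) :
    ((qq Λ n).Monic ∧ (qq Λ n).natDegree = n) ∧
      ((qq Λ (n + 1)).Monic ∧ (qq Λ (n + 1)).natDegree = n + 1) := by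
  induction n with
  | zero => simp [qq, monic_X]
  | succ n ih =>
    refine ⟨ih.2, ?_⟩
    obtain ⟨⟨a, b⟩, c, d⟩ := ih
    have hm : (X * qq Λ (n + 1)).Monic := monic_X.mul c
    have hd : (X * qq Λ (n + 1) : ℝ[X]).degree = (n + 2 : ℕ) := by
      rw [degree_mul, degree_X, degree_eq_natDegree c.ne_zero, d]; norm_cast; ring
    have hlt : (C (Λ (qq Λ (n + 1) * qq Λ (n + 1)) / Λ (qq Λ n * qq Λ n)) * qq Λ n).degree
        < (X * qq Λ (n + 1) : ℝ[X]).degree := by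
      rw [← smul_eq_C_mul]
      refine lt_of_le_of_lt (degree_smul_le _ _) ?_
      rw [hd, degree_eq_natDegree a.ne_zero, b]
      exact_mod_cast (by omega : n < n + 2)
    rw [show n + 1 + 1 = n + 2 from rfl, qq_two]
    refine ⟨hm.sub_of_left hlt, ?_⟩
    apply natDegree_eq_of_degree_eq_some
    rw [degree_sub_eq_left_of_degree_lt hlt, hd]

theorem qq_parity (Λ : ℝ[X] →ₗ[ℝ] ℝ) (n : ℕ) :
    ((qq Λ n).comp (-X) = (-1) ^ n * qq Λ n) ∧
      ((qq Λ (n + 1)).comp (-X) = (-1) ^ (n + 1) * qq Λ (n + 1)) := by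
  induction n with
  | zero => simp [qq]
  | succ n ih =>
    refine ⟨ih.2, ?_⟩
    rw [show n + 1 + 1 = n + 2 from rfl, qq_two]
    simp only [sub_comp, mul_comp, X_comp, C_comp, ih.1, ih.2]
    ring

theorem qq_odd (Λ : ℝ[X] →ₗ[ℝ] ℝ) (hs : ∀ g : ℝ[X], Λ (g.comp (-X)) = Λ g)
    (n : ℕ) : Λ (X * qq Λ n * qq Λ n) = 0 := by
  have h := hs (X * qq Λ n * qq Λ n)
  simp only [mul_comp, X_comp, (qq_parity Λ n).1] at h
  have e : -X * ((-1) ^ n * qq Λ n) * ((-1) ^ n * qq Λ n) = -(X * qq Λ n * qq Λ n) := by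
    have : ((-1 : ℝ[X]) ^ n) * (-1) ^ n = 1 := by rw [← mul_pow]; simp
    linear_combination (-(X * qq Λ n * qq Λ n)) * this
  rw [e, map_neg] at h
  linarith

theorem sub_lead {h q : ℝ[X]} {n : ℕ} (hq : q.Monic) (hd : q.natDegree = n)
    (hh : h.degree < (n + 1 : ℕ)) : (h - C (h.coeff n) * q).degree < (n : ℕ) := by
  rw [degree_lt_iff_coeff_zero]
  intro m hm
  rw [coeff_sub, coeff_C_mul]
  rcases hm.eq_or_lt with rfl | hm
  · have : q.coeff n = 1 := by rw [← hd]; exact hq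
    rw [this]; ring
  · rw [coeff_eq_zero_of_natDegree_lt (by omega : q.natDegree < m),
      (degree_lt_iff_coeff_zero _ _).1 hh m hm]; ring

theorem deg_X_mul {h : ℝ[X]} {n : ℕ} (hh : h.degree < (n : ℕ)) :
    (X * h : ℝ[X]).degree < (n + 1 : ℕ) := by
  rw [degree_lt_iff_coeff_zero]
  intro m hm
  cases m with
  | zero => omega
  | succ m =>
    rw [coeff_X_mul]
    exact (degree_lt_iff_coeff_zero _ _).1 hh m (by omega)

theorem qq_orth (Λ : ℝ[X] →ₗ[ℝ] ℝ) (hs : ∀ g : ℝ[X], Λ (g.comp (-X)) = Λ g)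
    (hpos : ∀ g : ℝ[X], g ≠ 0 → 0 < Λ (g * g)) (n : ℕ) :
    (∀ h : ℝ[X], h.degree < (n : ℕ) → Λ (qq Λ n * h) = 0) ∧
    (∀ h : ℝ[X], h.degree < (n + 1 : ℕ) → Λ (qq Λ (n + 1) * h) = 0) := by
  induction n with
  | zero =>
    constructor
    · intro h hh
      have : h = 0 := by
        rw [← degree_eq_bot]
        simpa using hh
      simp [this]
    · intro h hh
      have := sub_lead (q := 1) (n := 0) monic_one (by simp) hh
      have h0 : h = C (h.coeff 0) := by
        rw [← sub_eq_zero, ← degree_eq_bot]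
        simpa using this
      have ho := qq_odd Λ hs 0
      simp only [qq, mul_one] at ho
      rw [h0, mul_comm, ← smul_eq_C_mul, map_smul]
      simp [qq, ho]
  | succ n ih =>
    obtain ⟨i0, i1⟩ := ih
    refine ⟨i1, fun h hh => ?_⟩
    obtain ⟨⟨m0, d0⟩, m1, d1⟩ := qq_monic Λ n
    have hq0 := (hpos _ m0.ne_zero).ne'
    have hdeg0 : (qq Λ n).degree < (n + 1 : ℕ) := by
      rw [degree_eq_natDegree m0.ne_zero, d0]; exact_mod_cast Nat.lt_succ_self n
    -- three pieces
    have A : Λ (qq Λ (n + 2) * qq Λ (n + 1)) = 0 := by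
      have e : qq Λ (n + 2) * qq Λ (n + 1) = X * qq Λ (n + 1) * qq Λ (n + 1) -
        (Λ (qq Λ (n + 1) * qq Λ (n + 1)) / Λ (qq Λ n * qq Λ n)) • (qq Λ (n + 1) * qq Λ n) := by
        rw [qq_two, smul_eq_C_mul]; ring
      rw [e, map_sub, map_smul, qq_odd Λ hs, i1 _ hdeg0]; simp
    have B : Λ (qq Λ (n + 2) * qq Λ n) = 0 := by
      have l : (X * qq Λ n - qq Λ (n + 1) : ℝ[X]).degree < (n + 1 : ℕ) := by
        have hx : (X * qq Λ n).Monic := monic_X.mul m0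
        have hxd : (X * qq Λ n : ℝ[X]).degree = (n + 1 : ℕ) := by
          rw [degree_mul, degree_X, degree_eq_natDegree m0.ne_zero, d0]; norm_cast; ring
        have hyd : (qq Λ (n + 1)).degree = (n + 1 : ℕ) := by
          rw [degree_eq_natDegree m1.ne_zero, d1]
        rw [← hxd]
        exact degree_sub_lt_left (hxd.trans hyd.symm) hx.ne_zero (hx.trans m1.symm)
      have e : qq Λ (n + 2) * qq Λ n = qq Λ (n + 1) * qq Λ (n + 1) +
        qq Λ (n + 1) * (X * qq Λ n - qq Λ (n + 1)) -
        (Λ (qq Λ (n + 1) * qq Λ (n + 1)) / Λ (qq Λ n * qq Λ n)) • (qq Λ n * qq Λ n) := by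
        rw [qq_two, smul_eq_C_mul]; ring
      rw [e, map_sub, map_add, map_smul, i1 _ l, smul_eq_mul]
      field_simp; ring
    have D : ∀ h : ℝ[X], h.degree < (n : ℕ) → Λ (qq Λ (n + 2) * h) = 0 := by
      intro h hh
      have e : qq Λ (n + 2) * h = qq Λ (n + 1) * (X * h) -
        (Λ (qq Λ (n + 1) * qq Λ (n + 1)) / Λ (qq Λ n * qq Λ n)) • (qq Λ n * h) := by
        rw [qq_two, smul_eq_C_mul]; ring
      rw [e, map_sub, map_smul, i0 h hh, i1 _ (deg_X_mul hh)]; simp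
    have s1 := sub_lead m1 d1 hh
    have s2 := sub_lead m0 d0 s1
    set a := h.coeff (n + 1)
    set h1 := h - C a * qq Λ (n + 1)
    set b := h1.coeff n
    have e : qq Λ (n + 1 + 1) * h = a • (qq Λ (n + 2) * qq Λ (n + 1)) +
      b • (qq Λ (n + 2) * qq Λ n) + qq Λ (n + 2) * (h1 - C b * qq Λ n) := by
      simp only [smul_eq_C_mul, h1]; ring
    rw [e, map_add, map_add, map_smul, map_smul, A, B, D _ s2]; simp

theorem qq_norm (Λ : ℝ[X] →ₗ[ℝ] ℝ) (hs : ∀ g : ℝ[X], Λ (g.comp (-X)) = Λ g)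
    (hpos : ∀ g : ℝ[X], g ≠ 0 → 0 < Λ (g * g)) (n : ℕ) : Λ (X * X * qq Λ (n + 1) * qq Λ (n + 1)) =
    Λ (qq Λ (n + 2) * qq Λ (n + 2)) +
      Λ (qq Λ (n + 1) * qq Λ (n + 1)) ^ 2 / Λ (qq Λ n * qq Λ n) := by
  obtain ⟨⟨m0, d0⟩, m1, d1⟩ := qq_monic Λ n
  have hq0 := (hpos _ m0.ne_zero).ne'
  have hdeg0 : (qq Λ n).degree < (n + 1 + 1 : ℕ) := by
    rw [degree_eq_natDegree m0.ne_zero, d0]; exact_mod_cast (by omega : n < n + 1 + 1)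
  have o := (qq_orth Λ hs hpos (n + 1)).2 _ hdeg0
  set b := Λ (qq Λ (n + 1) * qq Λ (n + 1)) / Λ (qq Λ n * qq Λ n) with hb
  have hx : X * qq Λ (n + 1) = qq Λ (n + 2) + C b * qq Λ n := by rw [qq_two]; ring
  have e : X * X * qq Λ (n + 1) * qq Λ (n + 1) = qq Λ (n + 2) * qq Λ (n + 2) +
      (2 * b) • (qq Λ (n + 1 + 1) * qq Λ n) + (b * b) • (qq Λ n * qq Λ n) := by
    simp only [smul_eq_C_mul, C_mul]
    rw [show (C 2 : ℝ[X]) = 2 from rfl]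
    linear_combination (X * qq Λ (n + 1) + (qq Λ (n + 2) + C b * qq Λ n)) * hx
  rw [e, map_add, map_add, map_smul, map_smul, o, hb]
  simp only [smul_eq_mul]
  field_simp; ring

theorem prod_jacobi (μ : Measure ℝ) (Q : ℕ → ℝ[X])
    (hpos : ∀ n, 0 < ∫ x, ((Q n).eval x) ^ 2 ∂μ) (a b : ℕ) (hab : a ≤ b) :
    ∏ j ∈ Finset.Icc (a + 1) b, (jacobiA μ Q j) ^ 2 =
      (∫ x, ((Q b).eval x) ^ 2 ∂μ) / ∫ x, ((Q a).eval x) ^ 2 ∂μ := by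
  induction b, hab using Nat.le_induction with
  | base => simp [(hpos a).ne']
  | succ b hb ih =>
    rw [Finset.prod_Icc_succ_top (by omega), ih, jacobiA, div_pow, Real.sq_sqrt (hpos _).le,
      Real.sq_sqrt (hpos _).le]
    have := (hpos b).ne'
    have := (hpos a).ne'
    field_simp

theorem stmt_15 (γ : ℕ → ℝ) (hγ : ∀ s : ℕ, 0 < γ (s + 1) ∧ γ (s + 1) < 1 / 4)
    (μ : Measure ℝ) [IsProbabilityMeasure μ]
    (hμint : ∀ p : Polynomial ℝ, Integrable (fun x => p.eval x) μ)
    (hμpos : ∀ p : Polynomial ℝ, p ≠ 0 → 0 < ∫ x, (p.eval x) ^ 2 ∂μ)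
    (hμconv : ∀ p : Polynomial ℝ,
      Tendsto (fun s => nuInt γ s (fun x => p.eval x)) atTop (nhds (∫ x, p.eval x ∂μ)))
    (Q : ℕ → Polynomial ℝ) (hQmonic : ∀ n, (Q n).Monic) (hQdeg : ∀ n, (Q n).natDegree = n)
    (hQorth : ∀ n : ℕ, ∀ p : Polynomial ℝ, p.degree < (n : WithBot ℕ) →
      ∫ x, (Q n).eval x * p.eval x ∂μ = 0)
    (s k : ℕ) (hk : 1 ≤ k) :
    (∏ j ∈ Finset.Icc (2 ^ (s + 1) * k + 1) (2 ^ s * (2 * k + 1)), (jacobiA μ Q j) ^ 2) +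
      (∏ j ∈ Finset.Icc (2 ^ (s + 1) * k - 2 ^ s + 1) (2 ^ (s + 1) * k), (jacobiA μ Q j) ^ 2) =
      ∫ x, ((Q (2 ^ s)).eval x) ^ 2 ∂μ := by
  obtain ⟨L, hLdef⟩ : ∃ L : ℝ[X] →ₗ[ℝ] ℝ, ∀ p : ℝ[X], L p = ∫ x, p.eval x ∂μ :=
    ⟨{ toFun := fun p => ∫ x, p.eval x ∂μ
       map_add' := fun p q => by
        simp only [eval_add]; exact integral_add (hμint p) (hμint q)
       map_smul' := fun a p => by
        simp only [eval_smul, smul_eq_mul, RingHom.id_apply]; exact integral_const_mul _ _ },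
      fun p => rfl⟩
  have hL : ∀ p : ℝ[X], Tendsto (fun s => nuInt γ s (fun x => p.eval x)) atTop (nhds (L p)) := by
    intro p; rw [hLdef]; exact hμconv p
  have hL1 : L 1 = 1 := by simp [hLdef]
  have hsq : ∀ p : ℝ[X], ∫ x, (p.eval x) ^ 2 ∂μ = L (p * p) := by
    intro p; simp [hLdef, pow_two]
  have hLpos : ∀ p : ℝ[X], p ≠ 0 → 0 < L (p * p) := fun p hp => by
    rw [← hsq]; exact hμpos p hp
  have hQo : ∀ n : ℕ, ∀ p : ℝ[X], p.degree < (n : ℕ) → L (Q n * p) = 0 := by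
    intro n p hp; rw [hLdef]; simpa using hQorth n p hp
  have hQpos : ∀ n, 0 < ∫ x, ((Q n).eval x) ^ 2 ∂μ := fun n => hμpos _ (hQmonic n).ne_zero
  -- the functional at level `s`
  let Λ : ℕ → ℝ[X] →ₗ[ℝ] ℝ := fun s => L ∘ₗ (aeval (TT γ s)).toLinearMap
  have hΛ : ∀ s g, Λ s g = L (g.comp (TT γ s)) := fun s g => rfl
  have hΛs : ∀ s, ∀ g : ℝ[X], Λ s (g.comp (-X)) = Λ s g := fun s g => by
    rw [hΛ, hΛ]; exact Lf_symm γ hγ L hL s g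
  have hTd : ∀ s, 0 < (TT γ s).natDegree := fun s => by rw [(TT_monic γ s).2]; positivity
  have hΛp : ∀ s, ∀ g : ℝ[X], g ≠ 0 → 0 < Λ s (g * g) := fun s g hg => by
    rw [hΛ, mul_comp]
    apply hLpos
    intro h0
    rcases comp_eq_zero_iff.1 h0 with h | h
    · exact hg h
    · have := hTd s
      rw [h.2, natDegree_C] at this
      exact lt_irrefl _ this
  have hQeq : ∀ s n, Q (n * 2 ^ s) = (qq (Λ s) n).comp (TT γ s) := by
    intro s n
    obtain ⟨qm, qd⟩ := (qq_monic (Λ s) n).1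
    have cm : ((qq (Λ s) n).comp (TT γ s)).Monic := qm.comp (TT_monic γ s).1 (hTd s).ne'
    have cd : ((qq (Λ s) n).comp (TT γ s)).natDegree = n * 2 ^ s := by
      rw [natDegree_comp, qd, (TT_monic γ s).2]
    by_contra hne
    have hne' := sub_ne_zero.2 hne
    have hdlt : (Q (n * 2 ^ s) - (qq (Λ s) n).comp (TT γ s)).degree < (n * 2 ^ s : ℕ) := by
      have d1 : (Q (n * 2 ^ s)).degree = (n * 2 ^ s : ℕ) := by
        rw [degree_eq_natDegree (hQmonic _).ne_zero, hQdeg]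
      have d2 : ((qq (Λ s) n).comp (TT γ s)).degree = (n * 2 ^ s : ℕ) := by
        rw [degree_eq_natDegree cm.ne_zero, cd]
      rw [← d1]
      exact degree_sub_lt_left (d1.trans d2.symm) (hQmonic _).ne_zero ((hQmonic _).trans cm.symm)
    have h1 := hQo _ _ hdlt
    have h2 := Lf_orth γ hγ L hL hL1 s n _ (qq (Λ s) n) hdlt
      (qq_orth (Λ s) (hΛs s) (hΛp s) n).1
    have h3 := hLpos _ hne'
    rw [sub_mul, map_sub, h1, h2] at h3
    simp at h3
  obtain ⟨m, rfl⟩ : ∃ m, k = m + 1 := ⟨k - 1, by omega⟩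
  have i1 : 2 ^ (s + 1) * (m + 1) = (2 * m + 1 + 1) * 2 ^ s := by ring
  have i2 : 2 ^ s * (2 * (m + 1) + 1) = (2 * m + 1 + 2) * 2 ^ s := by ring
  have i3 : (2 * m + 1 + 1) * 2 ^ s - 2 ^ s = (2 * m + 1) * 2 ^ s := by
    rw [Nat.add_mul (2 * m + 1) 1]; simp
  rw [i1, i2, i3, prod_jacobi μ Q hQpos _ _ (Nat.mul_le_mul_right _ (by omega)),
    prod_jacobi μ Q hQpos _ _ (Nat.mul_le_mul_right _ (by omega))]
  have hn := qq_norm (Λ s) (hΛs s) (hΛp s) (2 * m + 1)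
  have ho1 := qq_odd (Λ (s + 1)) (hΛs (s + 1)) (m + 1)
  have ho0 := qq_odd (Λ (s + 1)) (hΛs (s + 1)) 0
  simp only [hΛ, mul_comp, X_comp, ← hQeq] at hn ho1 ho0
  have i4 : (m + 1) * 2 ^ (s + 1) = (2 * m + 1 + 1) * 2 ^ s := by ring
  have hQ0 : Q 0 = 1 := by
    have := hQeq s 0
    simpa [qq] using this
  have hQ1 : Q (2 ^ s) = TT γ s := by
    have := hQeq s 1
    simpa [qq] using this
  rw [zero_mul, hQ0, mul_one, mul_one, TT_succ, map_sub] at ho0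
  rw [i4, TT_succ] at ho1
  have p0 := hQpos ((2 * m + 1) * 2 ^ s)
  have p1 := hQpos ((2 * m + 1 + 1) * 2 ^ s)
  simp only [hsq] at p0 p1 ⊢
  rw [hQ1]
  set c := (r γ s) ^ 2 / 4 - r γ (s + 1) / 2
  have hC : L (C c) = c := by
    rw [show (C c : ℝ[X]) = c • 1 by rw [smul_eq_C_mul, mul_one], map_smul, hL1]; simp
  rw [hC] at ho0
  set q := Q ((2 * m + 1 + 1) * 2 ^ s)
  have e : (TT γ s * TT γ s - C c) * q * q = TT γ s * TT γ s * q * q - c • (q * q) := by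
    rw [smul_eq_C_mul]; ring
  rw [e, map_sub, map_smul, smul_eq_mul, hn] at ho1
  have hc : L (TT γ s * TT γ s) = c := by linarith
  rw [hc]
  have p0' := p0.ne'
  have p1' := p1.ne'
  have e2 : ∀ A B D c : ℝ, B ≠ 0 → D ≠ 0 → A + B ^ 2 / D - c * B = 0 → A / B + B / D = c := by
    intro A B D c hB hD h
    have : A = c * B - B ^ 2 / D := by linarith
    rw [this]; field_simp; ring
  exact e2 _ _ _ _ p1' p0' ho1
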